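/- Let y > 0, t > 0 be real numbers and let g₀, g₁ be real numbers with g₀ > |g₁| ≥ 0. Define τ₀ = y/(t + √(t² + t)) and T₁ = [2y g₀ + g₁² − √((2y g₀ + g₁²)² − 4y²(g₀² − g₁²))]/(2g₀² − 2g₁²). Then T₁ < t holds if and only if either (a) |g₁| > τ₀, or (b) |g₁| ≤ τ₀ and g₀ > (y − √(t² + t)·|g₁|)/t. -/

import Mathlib

/-- If the quadratic `(g * x - y) ^ 2 - a ^ 2 * (x ^ 2 + x)` is nonpositive at `x`, then its
smaller root is at most `x`. -/
lemma sub_le_sqrt_discrim_of_eval_nonpos {y g a x : ℝ} (hD : 0 < g ^ 2 - a ^ 2)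
    (hq : (g * x - y) ^ 2 - a ^ 2 * (x ^ 2 + x) ≤ 0) :
    2 * y * g + a ^ 2 - 2 * (g ^ 2 - a ^ 2) * x ≤
      Real.sqrt ((2 * y * g + a ^ 2) ^ 2 - 4 * y ^ 2 * (g ^ 2 - a ^ 2)) := by
  apply Real.le_sqrt_of_sq_le
  nlinarith [mul_nonneg hD.le (neg_nonneg.mpr hq)]

/-- A negative value of the quadratic forces the smaller root to be strictly below `x`. -/
lemma sub_lt_sqrt_discrim_of_eval_neg {y g a x : ℝ} (hD : 0 < g ^ 2 - a ^ 2)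
    (hq : (g * x - y) ^ 2 - a ^ 2 * (x ^ 2 + x) < 0) :
    2 * y * g + a ^ 2 - 2 * (g ^ 2 - a ^ 2) * x <
      Real.sqrt ((2 * y * g + a ^ 2) ^ 2 - 4 * y ^ 2 * (g ^ 2 - a ^ 2)) := by
  apply Real.lt_sqrt_of_sq_lt
  nlinarith [mul_pos hD (neg_pos.mpr hq)]

/-- The smaller root lies strictly below `t` exactly when `y < g * t + √(t ^ 2 + t) * a`. -/
lemma sub_lt_sqrt_discrim_iff {y t g a : ℝ} (hy : 0 < y) (ht : 0 < t) (ha : 0 ≤ a) (hg : a < g) :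
    2 * y * g + a ^ 2 - 2 * (g ^ 2 - a ^ 2) * t <
        Real.sqrt ((2 * y * g + a ^ 2) ^ 2 - 4 * y ^ 2 * (g ^ 2 - a ^ 2)) ↔
      y < g * t + Real.sqrt (t ^ 2 + t) * a := by
  have hg0 : 0 < g := ha.trans_lt hg
  have hD : 0 < g ^ 2 - a ^ 2 := by nlinarith
  have hs : Real.sqrt (t ^ 2 + t) ^ 2 = t ^ 2 + t := Real.sq_sqrt (by positivity)
  have hsa : 0 ≤ Real.sqrt (t ^ 2 + t) * a := by positivity
  have hsa2 : (Real.sqrt (t ^ 2 + t) * a) ^ 2 = a ^ 2 * (t ^ 2 + t) := by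
    rw [mul_pow, hs, mul_comm]
  constructor
  · contrapose!
    intro h
    have hq : a ^ 2 * (t ^ 2 + t) ≤ (g * t - y) ^ 2 := by nlinarith
    apply Real.sqrt_le_iff.mpr
    constructor
    · nlinarith [mul_nonneg hg0.le (show 0 ≤ y - g * t by linarith),
        mul_nonneg (sq_nonneg a) ht.le, sq_nonneg a]
    · nlinarith [mul_nonneg hD.le (sub_nonneg.mpr hq)]
  · intro h
    rcases lt_or_ge y (g * t) with hyt | hyt
    · have hx : y / g < t := (div_lt_iff₀ hg0).mpr (by linarith)
      have hx0 : 0 < y / g := div_pos hy hg0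
      have hroot := sub_le_sqrt_discrim_of_eval_nonpos (y := y) (x := y / g) hD (by
        rw [mul_div_cancel₀ y hg0.ne', sub_self]
        nlinarith [mul_nonneg (sq_nonneg a) (show 0 ≤ (y / g) ^ 2 + y / g by positivity)])
      nlinarith [mul_lt_mul_of_pos_left hx hD]
    · exact sub_lt_sqrt_discrim_of_eval_neg hD (by nlinarith)

/-- Let `y > 0`, `t > 0` and `g₀ > |g₁| ≥ 0`.  With
`τ₀ = y/(t + √(t² + t))` and
`T₁ = (2y g₀ + g₁² − √((2y g₀ + g₁²)² − 4y²(g₀² − g₁²)))/(2g₀² − 2g₁²)`,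
the phase-transition condition `T₁ < t` holds if and only if either
(a) `|g₁| > τ₀`, or (b) `|g₁| ≤ τ₀` and `g₀ > (y − √(t² + t)·|g₁|)/t`. -/
theorem phase_transition_condition_iff
    (y t g₀ g₁ : ℝ) (hy : 0 < y) (ht : 0 < t) (hg : |g₁| < g₀)
    (τ₀ T₁ : ℝ)
    (hτ₀ : τ₀ = y / (t + Real.sqrt (t ^ 2 + t)))
    (hT₁ : T₁ = (2 * y * g₀ + g₁ ^ 2 -
        Real.sqrt ((2 * y * g₀ + g₁ ^ 2) ^ 2 - 4 * y ^ 2 * (g₀ ^ 2 - g₁ ^ 2))) /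
        (2 * g₀ ^ 2 - 2 * g₁ ^ 2)) :
    T₁ < t ↔
      (τ₀ < |g₁| ∨ (|g₁| ≤ τ₀ ∧ (y - Real.sqrt (t ^ 2 + t) * |g₁|) / t < g₀)) := by
  have hD : 0 < g₀ ^ 2 - |g₁| ^ 2 := by nlinarith [abs_nonneg g₁]
  have hT : T₁ < t ↔ y < g₀ * t + Real.sqrt (t ^ 2 + t) * |g₁| := by
    rw [← sub_lt_sqrt_discrim_iff hy ht (abs_nonneg g₁) hg, hT₁, ← sq_abs g₁,
      div_lt_iff₀ (by linarith)]
    constructor <;> intro h <;> linarith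
  rw [hT, hτ₀, div_lt_iff₀ (by positivity), div_lt_iff₀ ht, le_div_iff₀ (by positivity)]
  constructor
  · intro h
    rcases lt_or_ge y (|g₁| * (t + Real.sqrt (t ^ 2 + t))) with h' | h'
    · exact Or.inl h'
    · exact Or.inr ⟨h', by linarith⟩
  · rintro (h | ⟨-, h⟩)
    · nlinarith [mul_lt_mul_of_pos_right hg ht]
    · linarith
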